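/- Let A ∈ (0,1), C > 0 and set B = 1 + A(C−1). Then the series E^C_{A,B}(z) = Σ_{n=0}^∞ [Γ(C+n)/(Γ(C)·n!·Γ(A n + B))]·z^n converges absolutely for every z ∈ ℂ, and the function s ↦ Γ(B)·E^C_{A,B}(−s) is completely monotone on (0,∞): it is infinitely differentiable and (−1)^k d^k/ds^k [Γ(B)·E^C_{A,B}(−s)] ≥ 0 for every s > 0 and every integer k ≥ 0. -/

import Mathlib

open MeasureTheory Finset Filter Real

/-- The three-parameter (Prabhakar) Mittag-Leffler function
`E^C_{A,B}(z) = Σ_{n≥0} Γ(C+n)·z^n/(Γ(C)·n!·Γ(An+B))`, as a real series. -/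
noncomputable def prabhakarML (A B C z : ℝ) : ℝ :=
  ∑' n : ℕ, Real.Gamma (C + n) / (Real.Gamma C * (n.factorial : ℝ) * Real.Gamma (A * n + B)) *
    z ^ n

/-- The series `∑ aₙ (-s)ⁿ / n!`. -/
noncomputable def altExpSeries (a : ℕ → ℝ) (s : ℝ) : ℝ :=
  ∑' n : ℕ, a n * ((-s) ^ n / (n.factorial : ℝ))

/-- The exponential generating series of `a` converges absolutely everywhere. -/
def EntireCoeff (a : ℕ → ℝ) : Prop :=
  ∀ R : ℝ, Summable fun n : ℕ => ‖a n * (R ^ n / (n.factorial : ℝ))‖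

lemma EntireCoeff.mono {a b : ℕ → ℝ} (ha : EntireCoeff a) (h : ∀ n, ‖b n‖ ≤ ‖a n‖) :
    EntireCoeff b := fun R =>
  (ha R).of_nonneg_of_le (fun _ => norm_nonneg _) fun n => by
    rw [norm_mul, norm_mul]
    exact mul_le_mul_of_nonneg_right (h n) (norm_nonneg _)

lemma EntireCoeff.const_mul {a : ℕ → ℝ} (ha : EntireCoeff a) (k : ℝ) :
    EntireCoeff fun n => k * a n := fun R => by
  simpa only [mul_assoc, norm_mul] using (ha R).mul_left ‖k‖

lemma EntireCoeff.hasDerivAt {a : ℕ → ℝ} (ha : EntireCoeff a)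
    (ha' : EntireCoeff fun n => a (n + 1)) (s : ℝ) :
    HasDerivAt (altExpSeries a) (-altExpSeries (fun n => a (n + 1)) s) s := by
  set R : ℝ := |s| + 1 with hR
  have hR0 : 0 < R := by positivity
  let g' : ℕ → ℝ → ℝ := fun n x => a n * ((n * (-x) ^ (n - 1) * -1) / (n.factorial : ℝ))
  have hg'succ : ∀ n x, g' (n + 1) x = -(a (n + 1) * ((-x) ^ n / (n.factorial : ℝ))) := by
    intro n x
    have : (n.factorial : ℝ) ≠ 0 := by positivity
    simp only [g', Nat.factorial_succ]
    push_cast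
    have h2 : (n : ℝ) + 1 ≠ 0 := by positivity
    field_simp
  have hsum : Summable fun n => ‖g' n (-R)‖ := by
    rw [← summable_nat_add_iff 1]
    simpa only [hg'succ, norm_neg, neg_neg] using ha' R
  have hder := hasDerivAt_tsum_of_isPreconnected (𝕜 := ℝ) (F := ℝ)
    (g := fun n x => a n * ((-x) ^ n / (n.factorial : ℝ))) (g' := g')
    (t := Set.Ioo (-R) R) (y₀ := 0) (y := s) hsum isOpen_Ioo isPreconnected_Ioo ?_ ?_ ?_ ?_ ?_
  · refine hder.congr_deriv ?_
    have hs : Summable fun n => g' n s := by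
      rw [← summable_nat_add_iff 1]
      simp only [hg'succ]
      exact ((ha' (-s)).of_norm).neg
    rw [hs.tsum_eq_zero_add]
    simp only [hg'succ, tsum_neg]
    simp [g', altExpSeries]
  · intro n x _
    have h := ((((hasDerivAt_id x).neg.pow n).div_const (n.factorial : ℝ)).const_mul (a n))
    exact h
  · intro n y hy
    have hy' : |y| ≤ R := abs_le.2 ⟨hy.1.le, hy.2.le⟩
    simp only [g', norm_mul, norm_div, norm_pow, norm_neg, Real.norm_eq_abs, abs_of_pos hR0]
    gcongr
  · exact ⟨by linarith, hR0⟩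
  · exact (ha (-0)).of_norm
  · exact ⟨by linarith [neg_abs_le s], by linarith [le_abs_self s]⟩

lemma EntireCoeff.contDiff {a : ℕ → ℝ} (ha : ∀ k, EntireCoeff fun n => a (n + k)) (m : ℕ) :
    ContDiff ℝ m (altExpSeries a) := by
  induction m generalizing a with
  | zero =>
    have h : Differentiable ℝ (altExpSeries a) := fun s =>
      (EntireCoeff.hasDerivAt (ha 0) (ha 1) s).differentiableAt
    exact contDiff_zero.2 h.continuous
  | succ m ih =>
    have hd := EntireCoeff.hasDerivAt (ha 0) (ha 1)
    have h : deriv (altExpSeries a) = fun s => -altExpSeries (fun n => a (n + 1)) s :=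
      funext fun s => (hd s).deriv
    push_cast
    rw [contDiff_succ_iff_deriv]
    refine ⟨fun s => (hd s).differentiableAt, by simp, ?_⟩
    rw [h]
    refine (ih fun k => ?_).neg
    simpa only [add_assoc, add_comm k 1] using ha (k + 1)

lemma EntireCoeff.iteratedDeriv {a : ℕ → ℝ} (ha : ∀ k, EntireCoeff fun n => a (n + k)) (k : ℕ) :
    iteratedDeriv k (altExpSeries a) =
      fun s => (-1) ^ k * altExpSeries (fun n => a (n + k)) s := by
  induction k with
  | zero => simp
  | succ k ih =>
    rw [iteratedDeriv_succ, ih]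
    funext s
    have h := EntireCoeff.hasDerivAt (ha k) (by
      simpa only [add_assoc, add_comm k 1] using ha (k + 1)) s
    rw [(h.const_mul ((-1 : ℝ) ^ k)).deriv]
    simp only [add_assoc, add_comm 1 k, pow_succ]
    ring

/-- Dividing the coefficients by `r + n` amounts to averaging `s ↦ altExpSeries a (s t)` against
`t ^ (r - 1)` over `(0, 1]`, hence preserves nonnegativity. -/
lemma EntireCoeff.nonneg_div {a : ℕ → ℝ} (ha : EntireCoeff a)
    (hpos : ∀ s, 0 ≤ s → 0 ≤ altExpSeries a s) {r : ℝ} (hr : 0 < r) {s : ℝ} (hs : 0 ≤ s) :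
    0 ≤ altExpSeries (fun n => a n / (r + n)) s := by
  set b : ℕ → ℝ := fun n => a n * ((-s) ^ n / (n.factorial : ℝ)) with hb
  have hexp : ∀ n : ℕ, -1 < r - 1 + n := fun n => by
    have : (0 : ℝ) ≤ n := n.cast_nonneg
    linarith
  have hint : ∀ n : ℕ, ∫ t in Set.Ioc (0 : ℝ) 1, t ^ (r - 1 + n) = 1 / (r + n) := fun n => by
    rw [← intervalIntegral.integral_of_le zero_le_one, integral_rpow (Or.inl (hexp n)),
      Real.one_rpow, Real.zero_rpow (by linarith [hexp n])]
    ring_nf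
  have hnorm : ∀ n : ℕ, ∫ t in Set.Ioc (0 : ℝ) 1, ‖b n * t ^ (r - 1 + n)‖ =
      ‖b n‖ * (1 / (r + n)) := fun n => by
    rw [← hint n, ← integral_const_mul]
    refine setIntegral_congr_fun measurableSet_Ioc fun t ht => ?_
    simp only [norm_mul, Real.norm_of_nonneg (Real.rpow_nonneg ht.1.le (r - 1 + n))]
  have hs1 := hasSum_integral_of_summable_integral_norm
    (μ := volume.restrict (Set.Ioc (0 : ℝ) 1)) (F := fun (n : ℕ) t => b n * t ^ (r - 1 + n))
    (fun n => by
      refine Integrable.const_mul ?_ _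
      exact (intervalIntegrable_iff_integrableOn_Ioc_of_le zero_le_one).1
        (intervalIntegral.intervalIntegrable_rpow' (hexp n)))
    (by
      simp only [hnorm]
      refine ((ha (-s)).mul_right (1 / r)).of_nonneg_of_le (fun n => by positivity) fun n => ?_
      have : (0 : ℝ) ≤ n := n.cast_nonneg
      gcongr
      linarith)
  have heq : altExpSeries (fun n => a n / (r + n)) s =
      ∫ t in Set.Ioc (0 : ℝ) 1, ∑' n : ℕ, b n * t ^ (r - 1 + n) := by
    rw [← hs1.tsum_eq, altExpSeries]
    refine tsum_congr fun n => ?_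
    rw [integral_const_mul, hint]
    simp only [hb]
    ring
  rw [heq]
  refine setIntegral_nonneg measurableSet_Ioc fun t ht => ?_
  have : ∀ n : ℕ, b n * t ^ (r - 1 + n) =
      t ^ (r - 1) * (a n * ((-(s * t)) ^ n / (n.factorial : ℝ))) := fun n => by
    rw [Real.rpow_add ht.1, Real.rpow_natCast, ← neg_mul, mul_pow]
    simp only [hb]
    ring
  simp only [this, tsum_mul_left]
  exact mul_nonneg (Real.rpow_nonneg ht.1.le _) (hpos _ (mul_nonneg hs ht.1.le))

lemma altExpSeries_const_nonneg (s : ℝ) : 0 ≤ altExpSeries (fun _ => 1) s := by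
  have : altExpSeries (fun _ => 1) s = Real.exp (-s) := by
    rw [Real.exp_eq_exp_ℝ, NormedSpace.exp_eq_tsum_div]
    simp [altExpSeries]
  rw [this]
  exact (Real.exp_pos _).le

lemma entireCoeff_const : EntireCoeff fun _ => 1 := fun R => by
  simpa using (Real.summable_pow_div_factorial |R|)

lemma entireCoeff_prod_and_nonneg {A c : ℝ} (hA : A ∈ Set.Ioo (0 : ℝ) 1) (hc : -1 < c) (N : ℕ) :
    (EntireCoeff fun n => ∏ j ∈ range N, (1 + A * (c + n) + j) / (1 + (c + n) + j)) ∧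
    ∀ s, 0 ≤ s → 0 ≤ altExpSeries
      (fun n => ∏ j ∈ range N, (1 + A * (c + n) + j) / (1 + (c + n) + j)) s := by
  induction N with
  | zero => simpa using ⟨entireCoeff_const, fun s _ => altExpSeries_const_nonneg s⟩
  | succ N ih =>
    obtain ⟨hE, hpos⟩ := ih
    set a : ℕ → ℝ := fun n => ∏ j ∈ range N, (1 + A * (c + n) + j) / (1 + (c + n) + j) with ha
    set r : ℝ := 1 + c + N with hr
    have hN : (0 : ℝ) ≤ N := N.cast_nonneg
    have hr0 : 0 < r := by linarith
    have hstep : (fun n : ℕ => ∏ j ∈ range (N + 1), (1 + A * (c + n) + j) / (1 + (c + n) + j)) =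
        fun n => A * a n + (1 - A) * (1 + N) * (a n / (r + n)) := by
      funext n
      have hn : (0 : ℝ) ≤ n := n.cast_nonneg
      rw [prod_range_succ]
      have h1 : 1 + (c + n) + N ≠ 0 := by
        have : 0 < 1 + (c + n) + N := by linarith
        exact this.ne'
      have h2 : r + n = 1 + (c + n) + N := by rw [hr]; ring
      rw [h2]
      change a n * _ = _
      field_simp
      ring
    have hE2 : EntireCoeff fun n => a n / (r + n) := by
      refine (hE.const_mul (1 / r)).mono fun n => ?_
      have hn : (0 : ℝ) ≤ n := n.cast_nonneg
      rw [norm_div, norm_mul, Real.norm_of_nonneg (by positivity : 0 ≤ r + n),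
        Real.norm_of_nonneg (by positivity : 0 ≤ 1 / r), div_eq_mul_one_div, mul_comm]
      gcongr
      linarith
    rw [hstep]
    have hE1 := hE.const_mul A
    have hE3 := hE2.const_mul ((1 - A) * (1 + N))
    refine ⟨fun R => ?_, fun s hs => ?_⟩
    · refine ((hE1 R).add (hE3 R)).of_nonneg_of_le (fun _ => norm_nonneg _) fun n => ?_
      rw [add_mul]
      exact norm_add_le _ _
    · have : altExpSeries (fun n => A * a n + (1 - A) * (1 + N) * (a n / (r + n))) s =
          A * altExpSeries a s + (1 - A) * (1 + N) * altExpSeries (fun n => a n / (r + n)) s := by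
        simp only [altExpSeries, ← tsum_mul_left]
        rw [← Summable.tsum_add]
        · exact tsum_congr fun n => by ring
        · exact (hE (-s)).of_norm.mul_left _
        · exact (hE2 (-s)).of_norm.mul_left _
      rw [this]
      have h1 : 0 ≤ 1 - A := by linarith [hA.2]
      have := hpos s hs
      have := hE.nonneg_div hpos hr0 hs
      have := hA.1
      positivity

/-- The finite approximants, built from Euler's limit formula, of `Γ(1 + q) / Γ(1 + A q)`. -/
noncomputable def gammaRatioSeq (A q : ℝ) (N : ℕ) : ℝ :=
  Real.GammaSeq (1 + q) N / Real.GammaSeq (1 + A * q) N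

lemma tendsto_gammaRatioSeq {A : ℝ} (hA : A ∈ Set.Ioo (0 : ℝ) 1) {q : ℝ} (hq : -1 < q) :
    Tendsto (gammaRatioSeq A q) atTop (nhds (Real.Gamma (1 + q) / Real.Gamma (1 + A * q))) := by
  refine (Real.GammaSeq_tendsto_Gamma _).div (Real.GammaSeq_tendsto_Gamma _) ?_
  exact (Real.Gamma_pos_of_pos (by nlinarith [hA.1, hA.2])).ne'

lemma gammaRatioSeq_eq {A : ℝ} (hA : A ∈ Set.Ioo (0 : ℝ) 1) {q : ℝ} (hq : -1 < q)
    {N : ℕ} (hN : 0 < N) :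
    gammaRatioSeq A q N = (N : ℝ) ^ ((1 - A) * q) *
      ∏ j ∈ range (N + 1), (1 + A * q + j) / (1 + q + j) := by
  have hN' : (0 : ℝ) < N := by exact_mod_cast hN
  have hp : 0 < 1 + A * q := by nlinarith [hA.1, hA.2]
  have h1 : ∏ j ∈ range (N + 1), (1 + A * q + j) ≠ 0 :=
    (prod_pos fun j _ => by positivity).ne'
  have hp' : 0 < 1 + q := by linarith
  have h2 : ∏ j ∈ range (N + 1), (1 + q + j) ≠ 0 :=
    (prod_pos fun j _ => by positivity).ne'
  have h3 : (N : ℝ) ^ (1 + q) = (N : ℝ) ^ ((1 - A) * q) * (N : ℝ) ^ (1 + A * q) := by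
    rw [← Real.rpow_add hN']
    ring_nf
  have h4 := (Real.rpow_pos_of_pos hN' (1 + A * q)).ne'
  rw [gammaRatioSeq, Real.GammaSeq, Real.GammaSeq, prod_div_distrib, h3]
  have h5 : (N.factorial : ℝ) ≠ 0 := by positivity
  field_simp

lemma gammaRatioSeq_pos {A : ℝ} (hA : A ∈ Set.Ioo (0 : ℝ) 1) {q : ℝ} (hq : -1 < q)
    {N : ℕ} (hN : 0 < N) :
    0 < gammaRatioSeq A q N := by
  have hN' : (0 : ℝ) < N := by exact_mod_cast hN
  have hp : 0 < 1 + A * q := by nlinarith [hA.1, hA.2]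
  have hp' : 0 < 1 + q := by linarith
  rw [gammaRatioSeq_eq hA hq hN]
  exact mul_pos (Real.rpow_pos_of_pos hN' _) (prod_pos fun j _ => by positivity)

lemma altExpSeries_gammaRatioSeq_nonneg {A c : ℝ} (hA : A ∈ Set.Ioo (0 : ℝ) 1) (hc : -1 < c) {N : ℕ}
    (hN : 0 < N) {s : ℝ} (hs : 0 ≤ s) :
    0 ≤ altExpSeries (fun n => gammaRatioSeq A (c + n) N) s := by
  have hN' : (0 : ℝ) < N := by exact_mod_cast hN
  have h : altExpSeries (fun n => gammaRatioSeq A (c + n) N) s = (N : ℝ) ^ ((1 - A) * c) *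
      altExpSeries (fun n => ∏ j ∈ range (N + 1), (1 + A * (c + n) + j) / (1 + (c + n) + j))
        ((N : ℝ) ^ (1 - A) * s) := by
    simp only [altExpSeries, ← tsum_mul_left]
    refine tsum_congr fun n => ?_
    have hn : (0 : ℝ) ≤ n := n.cast_nonneg
    rw [gammaRatioSeq_eq hA (by linarith) hN, mul_add, Real.rpow_add hN', Real.rpow_mul hN'.le _ n,
      Real.rpow_natCast, ← mul_neg, mul_pow]
    ring
  rw [h]
  exact mul_nonneg (Real.rpow_nonneg hN'.le _)
    ((entireCoeff_prod_and_nonneg hA hc (N + 1)).2 _ (mul_nonneg (Real.rpow_nonneg hN'.le _) hs))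

lemma prod_add_div_le {A : ℝ} (hA : A ∈ Set.Ioo (0 : ℝ) 1) {x : ℝ} (hx : 0 < x) (N : ℕ) :
    ∏ j ∈ range (N + 1), (x + A + j) / (x + j) ≤ (1 + A / x) * ((x + N) / x) ^ A := by
  have hA0 := hA.1
  induction N with
  | zero =>
    simp only [zero_add, range_one, prod_singleton, Nat.cast_zero, add_zero, div_self hx.ne',
      Real.one_rpow, mul_one]
    exact (by field_simp : (x + A) / x = 1 + A / x).le
  | succ N ih =>
    rw [prod_range_succ]
    have hy : 0 < x + N := by positivity
    have hfac : (x + A + (N + 1 : ℕ)) / (x + (N + 1 : ℕ)) ≤ ((x + N + 1) / (x + N)) ^ A := by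
      push_cast
      set y := x + N with hydef
      have hb := rpow_one_add_le_one_add_mul_self (s := -(1 / (y + 1)))
        (by
          have : 1 / (y + 1) ≤ 1 := by rw [div_le_one (by positivity)]; linarith
          linarith) hA.1.le hA.2.le
      have h1 : 1 + -(1 / (y + 1)) = ((y + 1) / y)⁻¹ := by field_simp; ring
      rw [h1, Real.inv_rpow (by positivity)] at hb
      have hP : 0 < ((y + 1) / y) ^ A := by positivity
      have hb2 : 1 ≤ (1 + A * -(1 / (y + 1))) * ((y + 1) / y) ^ A := by
        have := mul_le_mul_of_nonneg_right hb hP.le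
        rwa [inv_mul_cancel₀ hP.ne'] at this
      have h2 : (x + A + (N + 1)) / (x + (N + 1)) = 1 + A / (y + 1) := by
        rw [hydef]; field_simp; ring
      rw [h2]
      set u := A / (y + 1) with hu
      have h3 : 1 + A * -(1 / (y + 1)) = 1 - u := by rw [hu]; ring
      rw [h3] at hb2
      have hu0 : 0 < u := by positivity
      nlinarith [mul_le_mul_of_nonneg_left hb2 (by linarith : 0 ≤ 1 + u),
        mul_pos (mul_pos hu0 hu0) hP]
    calc _ ≤ ((1 + A / x) * ((x + N) / x) ^ A) * ((x + N + 1) / (x + N)) ^ A := by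
          gcongr
      _ = _ := by
          rw [mul_assoc, ← Real.mul_rpow (by positivity) (by positivity)]
          push_cast
          congr 2
          field_simp
          ring

/-- A bound, uniform in `N`, for `gammaRatioSeq A (q + 1) N / gammaRatioSeq A q N`. -/
noncomputable def ratioBound (A q : ℝ) : ℝ :=
  (1 + q) * (1 + A / (1 + A * q)) * (1 + A * q) ^ (-A)

lemma ratioBound_nonneg {A : ℝ} (hA : A ∈ Set.Ioo (0 : ℝ) 1) {q : ℝ} (hq : -1 < q) :
    0 ≤ ratioBound A q := by
  have hp : 0 < 1 + A * q := by nlinarith [hA.1, hA.2]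
  have hp' : 0 < 1 + q := by linarith
  have := hA.1
  unfold ratioBound
  positivity

lemma gammaRatioSeq_add_one_le {A : ℝ} (hA : A ∈ Set.Ioo (0 : ℝ) 1) {q : ℝ} (hq : -1 < q) {N : ℕ}
    (hN : 0 < N) : gammaRatioSeq A (q + 1) N ≤ ratioBound A q * gammaRatioSeq A q N := by
  have hN' : (0 : ℝ) < N := by exact_mod_cast hN
  have hA0 := hA.1
  have hA1 : 0 < 1 - A := by linarith [hA.2]
  have hp : 0 < 1 + A * q := by nlinarith [hA.1, hA.2]
  have hp' : 0 < 1 + q := by linarith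
  have hpos := gammaRatioSeq_pos hA hq hN
  have hshift : ∏ j ∈ range (N + 1), (1 + q + j) / (1 + (q + 1) + j) =
      (1 + q) / (1 + q + (N + 1)) := by
    rw [prod_congr rfl (g := fun j : ℕ => (1 + q + j) / (1 + q + (j + 1 : ℕ)))
      (fun j _ => by push_cast; ring_nf)]
    clear hN hN' hpos
    induction N with
    | zero => simp
    | succ N ih =>
      rw [prod_range_succ, ih]
      push_cast
      have : 1 + q + ((N : ℝ) + 1) ≠ 0 := by positivity
      field_simp
  have hsplit : gammaRatioSeq A (q + 1) N = gammaRatioSeq A q N * ((N : ℝ) ^ (1 - A) *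
      ((1 + q) / (1 + q + (N + 1))) *
      ∏ j ∈ range (N + 1), (1 + A * q + A + j) / (1 + A * q + j)) := by
    rw [gammaRatioSeq_eq hA (by linarith) hN, gammaRatioSeq_eq hA hq hN, ← hshift, mul_add,
      Real.rpow_add hN', mul_one]
    have : ∏ j ∈ range (N + 1), (1 + A * (q + 1) + j) / (1 + (q + 1) + j) =
        (∏ j ∈ range (N + 1), (1 + A * q + j) / (1 + q + j)) *
        (∏ j ∈ range (N + 1), (1 + q + j) / (1 + (q + 1) + j)) *
        ∏ j ∈ range (N + 1), (1 + A * q + A + j) / (1 + A * q + j) := by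
      rw [← prod_mul_distrib, ← prod_mul_distrib]
      refine prod_congr rfl fun j _ => ?_
      have h1 : 1 + A * q + j ≠ 0 := by positivity
      have h2 : 1 + q + j ≠ 0 := by positivity
      have h3 : 1 + (q + 1) + j ≠ 0 := by
        have : 0 < 1 + (q + 1) + (j : ℝ) := by linarith [(j.cast_nonneg : (0 : ℝ) ≤ j)]
        exact this.ne'
      field_simp
      ring
    rw [this]
    ring
  rw [hsplit, mul_comm]
  gcongr
  set M : ℝ := 1 + q + (N + 1) with hM
  have hM0 : 0 < M := by positivity
  have hle : 1 + A * q + N ≤ M := by nlinarith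
  calc _ ≤ M ^ (1 - A) * ((1 + q) / M) * ((1 + A / (1 + A * q)) * (M / (1 + A * q)) ^ A) := by
        refine mul_le_mul ?_ ((prod_add_div_le hA hp N).trans ?_)
          (prod_nonneg fun j _ => by positivity) (by positivity)
        · gcongr
          linarith
        · gcongr
    _ = ratioBound A q := by
        rw [ratioBound, Real.div_rpow hM0.le hp.le, Real.rpow_neg hp.le]
        have h : M ^ (1 - A) * M ^ A = M := by
          rw [← Real.rpow_add hM0, sub_add_cancel, Real.rpow_one]
        have h' : M ^ (1 - A) = M / M ^ A := by
          rw [eq_div_iff (by positivity), h]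
        rw [h']
        have : M ^ A ≠ 0 := by positivity
        field_simp

lemma gammaRatioSeq_le_prod {A c : ℝ} (hA : A ∈ Set.Ioo (0 : ℝ) 1) (hc : -1 < c)
    {N : ℕ} (hN : 0 < N)
    (n : ℕ) :
    gammaRatioSeq A (c + n) N ≤ gammaRatioSeq A c N * ∏ i ∈ range n, ratioBound A (c + i) := by
  induction n with
  | zero => simp
  | succ n ih =>
    have hq : -1 < c + n := by linarith [(n.cast_nonneg : (0 : ℝ) ≤ n)]
    rw [prod_range_succ, ← mul_assoc, mul_comm _ (ratioBound _ _)]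
    push_cast
    rw [← add_assoc]
    exact (gammaRatioSeq_add_one_le hA hq hN).trans
      (mul_le_mul_of_nonneg_left ih (ratioBound_nonneg hA hq))

lemma tendsto_ratioBound_div {A : ℝ} (hA : A ∈ Set.Ioo (0 : ℝ) 1) (c : ℝ) :
    Tendsto (fun n : ℕ => ratioBound A (c + n) / (n + 1)) atTop (nhds 0) := by
  have hcast : Tendsto (fun n : ℕ => (n : ℝ)) atTop atTop := tendsto_natCast_atTop_atTop
  have hlin : Tendsto (fun n : ℕ => 1 + A * (c + n)) atTop atTop :=
    tendsto_atTop_add_const_left _ _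
      ((tendsto_atTop_add_const_left _ c hcast).const_mul_atTop hA.1)
  have h1 : Tendsto (fun n : ℕ => 1 + c / ((n : ℝ) + 1)) atTop (nhds (1 + 0)) :=
    tendsto_const_nhds.add
      (tendsto_const_nhds.div_atTop (tendsto_atTop_add_const_right _ 1 hcast))
  have h2 : Tendsto (fun n : ℕ => 1 + A / (1 + A * (c + n))) atTop (nhds (1 + 0)) :=
    tendsto_const_nhds.add (tendsto_const_nhds.div_atTop hlin)
  have h3 := (tendsto_rpow_neg_atTop hA.1).comp hlin
  have h := (h1.mul h2).mul h3
  rw [mul_zero] at h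
  refine h.congr fun n => ?_
  have : (n : ℝ) + 1 ≠ 0 := by positivity
  simp only [ratioBound, Function.comp]
  field_simp
  ring

lemma entireCoeff_prod_ratioBound {A : ℝ} (hA : A ∈ Set.Ioo (0 : ℝ) 1) (c : ℝ) :
    EntireCoeff fun n => ∏ i ∈ range n, ratioBound A (c + i) := fun R => by
  refine Summable.norm (summable_of_ratio_norm_eventually_le (r := 1 / 2) (by norm_num) ?_)
  have h := ((tendsto_ratioBound_div hA c).const_mul R).norm
  simp only [mul_zero, norm_zero] at h
  filter_upwards [h.eventually_le_const (by norm_num : (0 : ℝ) < 1 / 2)] with n hn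
  have : (∏ i ∈ range (n + 1), ratioBound A (c + i)) * (R ^ (n + 1) / ((n + 1).factorial : ℝ)) =
      (R * (ratioBound A (c + n) / (n + 1))) *
        ((∏ i ∈ range n, ratioBound A (c + i)) * (R ^ n / (n.factorial : ℝ))) := by
    rw [prod_range_succ, Nat.factorial_succ]
    push_cast
    have h1 : (n.factorial : ℝ) ≠ 0 := by positivity
    have h2 : (n : ℝ) + 1 ≠ 0 := by positivity
    field_simp
    ring
  rw [this, norm_mul]
  gcongr

lemma exists_gammaRatioSeq_le {A c : ℝ} (hA : A ∈ Set.Ioo (0 : ℝ) 1) (hc : -1 < c) :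
    ∃ K : ℝ, ∀ N : ℕ, 0 < N → ∀ n : ℕ,
      ‖gammaRatioSeq A (c + n) N‖ ≤ K * ∏ i ∈ range n, ratioBound A (c + i) := by
  obtain ⟨K, hK⟩ := (tendsto_gammaRatioSeq hA hc).bddAbove_range
  refine ⟨K, fun N hN n => ?_⟩
  have hq : ∀ i : ℕ, -1 < c + i := fun i => by linarith [(i.cast_nonneg : (0 : ℝ) ≤ i)]
  rw [Real.norm_of_nonneg (gammaRatioSeq_pos hA (hq n) hN).le]
  exact (gammaRatioSeq_le_prod hA hc hN n).trans (mul_le_mul_of_nonneg_right (hK ⟨N, rfl⟩)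
    (prod_nonneg fun i _ => ratioBound_nonneg hA (hq i)))

lemma entireCoeff_gammaRatio {A c : ℝ} (hA : A ∈ Set.Ioo (0 : ℝ) 1) (hc : -1 < c) :
    EntireCoeff fun n => Real.Gamma (1 + (c + n)) / Real.Gamma (1 + A * (c + n)) := by
  obtain ⟨K, hK⟩ := exists_gammaRatioSeq_le hA hc
  refine ((entireCoeff_prod_ratioBound hA c).const_mul K).mono fun n => ?_
  have hq : -1 < c + n := by linarith [(n.cast_nonneg : (0 : ℝ) ≤ n)]
  refine le_of_tendsto (tendsto_gammaRatioSeq hA hq).norm ?_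
  filter_upwards [eventually_gt_atTop 0] with N hN
  exact (hK N hN n).trans (le_abs_self _)

lemma altExpSeries_gammaRatio_nonneg {A c : ℝ} (hA : A ∈ Set.Ioo (0 : ℝ) 1) (hc : -1 < c) {s : ℝ}
    (hs : 0 ≤ s) :
    0 ≤ altExpSeries (fun n => Real.Gamma (1 + (c + n)) / Real.Gamma (1 + A * (c + n))) s := by
  obtain ⟨K, hK⟩ := exists_gammaRatioSeq_le hA hc
  have hlim : Tendsto (fun N => altExpSeries (fun n => gammaRatioSeq A (c + n) N) s) atTop
      (nhds (altExpSeries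
        (fun n => Real.Gamma (1 + (c + n)) / Real.Gamma (1 + A * (c + n))) s)) := by
    refine tendsto_tsum_of_dominated_convergence
      (((entireCoeff_prod_ratioBound hA c).const_mul K) (-s)) (fun n => ?_) ?_
    · have hq : -1 < c + n := by linarith [(n.cast_nonneg : (0 : ℝ) ≤ n)]
      exact (tendsto_gammaRatioSeq hA hq).mul_const _
    · filter_upwards [eventually_gt_atTop 0] with N hN n
      rw [norm_mul, norm_mul]
      exact mul_le_mul_of_nonneg_right ((hK N hN n).trans (le_abs_self _)) (norm_nonneg _)
  refine ge_of_tendsto hlim ?_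
  filter_upwards [eventually_gt_atTop 0] with N hN
  exact altExpSeries_gammaRatioSeq_nonneg hA hc hN hs

/-- for `A ∈ (0,1)`, `C > 0` and `B = 1 + A(C−1)`, the Prabhakar
Mittag-Leffler series converges absolutely everywhere and `s ↦ Γ(B)·E^C_{A,B}(−s)` is
completely monotone on `(0,∞)`. -/
theorem prabhakar_completely_monotone
    (A B C : ℝ) (hA : A ∈ Set.Ioo (0 : ℝ) 1) (hC : 0 < C) (hB : B = 1 + A * (C - 1)) :
    (∀ z : ℂ, Summable fun n : ℕ =>
      ‖((Real.Gamma (C + n) / (Real.Gamma C * (n.factorial : ℝ) *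
          Real.Gamma (A * n + B)) : ℝ) : ℂ) * z ^ n‖) ∧
    ContDiffOn ℝ (⊤ : ℕ∞) (fun s : ℝ => Real.Gamma B * prabhakarML A B C (-s)) (Set.Ioi 0) ∧
    ∀ k : ℕ, ∀ s > (0 : ℝ),
      0 ≤ (-1 : ℝ) ^ k * iteratedDerivWithin k
        (fun s : ℝ => Real.Gamma B * prabhakarML A B C (-s)) (Set.Ioi 0) s := by
  set w : ℕ → ℝ := fun n =>
    Real.Gamma (1 + (C - 1 + n)) / Real.Gamma (1 + A * (C - 1 + n)) with hw
  have hcoeff : ∀ n : ℕ, Real.Gamma (C + n) / (Real.Gamma C * (n.factorial : ℝ) *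
      Real.Gamma (A * n + B)) = (Real.Gamma C)⁻¹ * (w n / (n.factorial : ℝ)) := fun n => by
    have h1 : 1 + (C - 1 + n) = C + n := by ring
    have h2 : 1 + A * (C - 1 + n) = A * n + B := by rw [hB]; ring
    simp only [hw, h1, h2, div_eq_mul_inv, mul_inv]
    ring
  have hwshift : ∀ k : ℕ, (fun n => w (n + k)) = fun n : ℕ =>
      Real.Gamma (1 + ((C - 1 + k) + n)) / Real.Gamma (1 + A * ((C - 1 + k) + n)) := fun k => by
    funext n
    simp only [hw]
    push_cast
    ring_nf
  have hk1 : ∀ k : ℕ, -1 < C - 1 + k := fun k => by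
    linarith [(k.cast_nonneg : (0 : ℝ) ≤ k)]
  have hE : ∀ k, EntireCoeff fun n => w (n + k) := fun k => by
    rw [hwshift]
    exact entireCoeff_gammaRatio hA (hk1 k)
  have hfun : (fun s : ℝ => Real.Gamma B * prabhakarML A B C (-s)) =
      fun s => Real.Gamma B / Real.Gamma C * altExpSeries w s := by
    funext s
    simp only [prabhakarML, altExpSeries, hcoeff, ← tsum_mul_left]
    exact tsum_congr fun n => by ring
  have hΓC : 0 < Real.Gamma C := Real.Gamma_pos_of_pos hC
  have hΓB : 0 < Real.Gamma B := Real.Gamma_pos_of_pos (by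
    rw [hB]
    nlinarith [hA.1, hA.2, mul_pos hA.1 hC])
  have hsmooth : ∀ m : ℕ, ContDiff ℝ m (altExpSeries w) := EntireCoeff.contDiff hE
  rw [hfun]
  refine ⟨fun z => ?_, (contDiff_const.mul (contDiff_infty.2 hsmooth)).contDiffOn,
    fun k s hs => ?_⟩
  · refine ((hE 0 ‖z‖).mul_left ((Real.Gamma C)⁻¹)).congr fun n => ?_
    rw [hcoeff]
    simp only [norm_mul, norm_div, norm_inv, norm_pow, Complex.norm_real, norm_norm,
      Real.norm_of_nonneg hΓC.le, add_zero]
    ring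
  · rw [iteratedDerivWithin_of_isOpen isOpen_Ioi hs, iteratedDeriv_const_mul_field,
      EntireCoeff.iteratedDeriv hE, hwshift]
    have h1 : ((-1 : ℝ) ^ k) * (-1) ^ k = 1 := by
      rw [← mul_pow]
      norm_num
    have h2 := altExpSeries_gammaRatio_nonneg hA (hk1 k) hs.le
    have h3 : 0 ≤ Real.Gamma B / Real.Gamma C := by positivity
    calc (0 : ℝ) ≤ _ := mul_nonneg h3 h2
      _ = _ := by
        rw [mul_left_comm, ← mul_assoc ((-1 : ℝ) ^ k), h1, one_mul]
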